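/- Let Γ be a connected, locally finite, vertex-transitive simple graph of degree d that is NOT unimodular, and let R_n denote the simple random walk on Γ started at a root o. Then H(R_{2n}) − H(R_n) ≥ n/(2d²) for every n ≥ 1. -/

import Mathlib

open scoped BigOperators Classical

/-- A graph is locally finite if every vertex has finitely many neighbours. -/
def LocFin {V : Type*} (Γ : SimpleGraph V) : Prop := ∀ v, (Γ.neighborSet v).Finite

/-- A graph is vertex-transitive if its automorphism group acts transitively on vertices. -/
def VertexTransitive {V : Type*} (Γ : SimpleGraph V) : Prop :=
  ∀ u v : V, ∃ φ : Γ ≃g Γ, φ u = v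

/-- The distribution of the simple random walk on `Γ` started at `o` after `n` steps:
at each step the walk moves to a uniformly random neighbour of the current vertex. -/
noncomputable def walkP {V : Type*} (Γ : SimpleGraph V) (o : V) : ℕ → V → ℝ
  | 0 => fun v => if v = o then 1 else 0
  | n + 1 => fun v =>
      ∑' w, (if Γ.Adj w v then walkP Γ o n w / ((Γ.neighborSet w).ncard : ℝ) else 0)

/-- The Shannon entropy `H(R_n)` of the simple random walk after `n` steps. -/
noncomputable def walkEnt {V : Type*} (Γ : SimpleGraph V) (o : V) (n : ℕ) : ℝ :=
  -∑' v, walkP Γ o n v * Real.log (walkP Γ o n v)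

/-- A vertex-transitive graph is unimodular if `|G_v w| = |G_w v|` for all `v, w`, where
`G_v w` is the orbit of `w` under the stabilizer of `v` in the automorphism group. -/
def GraphUnimodular {V : Type*} (Γ : SimpleGraph V) : Prop :=
  ∀ v w : V,
    {x | ∃ φ : Γ ≃g Γ, φ v = v ∧ φ w = x}.ncard =
    {x | ∃ φ : Γ ≃g Γ, φ w = w ∧ φ v = x}.ncard

open Finset

/-- Data processing: passing from `Y` to `Z` through the kernel `P` does not increase the mutual
information with `X`, both sides being written as differences of entropies. -/
theorem mutualInfo_mono {α : Type*} (X Y Z : Finset α) (w q q' : α → ℝ) (K K' P : α → α → ℝ)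
    (hw : ∀ x, 0 ≤ w x) (hK : ∀ x y, 0 ≤ K x y) (hP : ∀ y z, 0 ≤ P y z)
    (hq : ∀ y, q y = ∑ x ∈ X, w x * K x y)
    (hK' : ∀ x ∈ X, ∀ z, K' x z = ∑ y ∈ Y, K x y * P y z)
    (hq' : ∀ z, q' z = ∑ y ∈ Y, q y * P y z)
    (hw1 : ∑ x ∈ X, w x = 1) (hK1 : ∀ x ∈ X, ∑ y ∈ Y, K x y = 1)
    (hP1 : ∀ y ∈ Y, ∑ z ∈ Z, P y z = 1) :
    ∑ x ∈ X, w x * ∑ z ∈ Z, K' x z * Real.log (K' x z) - ∑ z ∈ Z, q' z * Real.log (q' z) ≤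
      ∑ x ∈ X, w x * ∑ y ∈ Y, K x y * Real.log (K x y) - ∑ y ∈ Y, q y * Real.log (q y) := by
  have hq0 : ∀ y, 0 ≤ q y := fun y => by
    rw [hq]; exact sum_nonneg fun x _ => mul_nonneg (hw x) (hK x y)
  have hq'0 : ∀ z, 0 ≤ q' z := fun z => by
    rw [hq']; exact sum_nonneg fun y _ => mul_nonneg (hq0 y) (hP y z)
  have hK'0 : ∀ x ∈ X, ∀ z, 0 ≤ K' x z := fun x hx z => by
    rw [hK' x hx]; exact sum_nonneg fun y _ => mul_nonneg (hK x y) (hP y z)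
  have hterm : ∀ x ∈ X, ∀ y ∈ Y, ∀ z ∈ Z,
      w x * K x y * P y z * (Real.log (K' x z) - Real.log (q' z) - Real.log (K x y)
        + Real.log (q y)) ≤ w x * K' x z / q' z * (q y * P y z) - w x * K x y * P y z := by
    intro x hx y hy z hz
    rcases (mul_nonneg (mul_nonneg (hw x) (hK x y)) (hP y z)).eq_or_lt with h0 | hpos
    · rw [← h0, zero_mul, sub_zero]
      exact mul_nonneg (div_nonneg (mul_nonneg (hw x) (hK'0 x hx z)) (hq'0 z))
        (mul_nonneg (hq0 y) (hP y z))
    · have hwx : 0 < w x := (hw x).lt_of_ne' fun h => by simp [h] at hpos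
      have hKxy : 0 < K x y := (hK x y).lt_of_ne' fun h => by simp [h] at hpos
      have hPyz : 0 < P y z := (hP y z).lt_of_ne' fun h => by simp [h] at hpos
      have hqy : 0 < q y := (mul_pos hwx hKxy).trans_le <| by
        rw [hq]
        exact single_le_sum (f := fun x => w x * K x y)
          (fun x _ => mul_nonneg (hw x) (hK x y)) hx
      have hq'z : 0 < q' z := (mul_pos hqy hPyz).trans_le <| by
        rw [hq']
        exact single_le_sum (f := fun y => q y * P y z)
          (fun y _ => mul_nonneg (hq0 y) (hP y z)) hy
      have hK'xz : 0 < K' x z := (mul_pos hKxy hPyz).trans_le <| by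
        rw [hK' x hx]
        exact single_le_sum (f := fun y => K x y * P y z)
          (fun y _ => mul_nonneg (hK x y) (hP y z)) hy
      have hlog : Real.log (K' x z) - Real.log (q' z) - Real.log (K x y) + Real.log (q y) ≤
          K' x z * q y / (q' z * K x y) - 1 := by
        refine le_trans (le_of_eq ?_) (Real.log_le_sub_one_of_pos (by positivity))
        rw [Real.log_div (by positivity) (by positivity), Real.log_mul hK'xz.ne' hqy.ne',
          Real.log_mul hq'z.ne' hKxy.ne']
        ring
      refine (mul_le_mul_of_nonneg_left hlog hpos.le).trans (le_of_eq ?_)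
      field_simp
  have hsum := sum_le_sum fun x hx => sum_le_sum fun y hy => sum_le_sum fun z hz =>
    hterm x hx y hy z hz
  have hone : ∑ x ∈ X, ∑ y ∈ Y, ∑ z ∈ Z, w x * K x y * P y z = 1 := by
    rw [← hw1]
    refine sum_congr rfl fun x hx => ?_
    have : ∀ y ∈ Y, ∑ z ∈ Z, w x * K x y * P y z = w x * K x y := fun y hy => by
      rw [← mul_sum, hP1 y hy, mul_one]
    rw [sum_congr rfl this, ← mul_sum, hK1 x hx, mul_one]
  have hle : ∑ x ∈ X, ∑ y ∈ Y, ∑ z ∈ Z, w x * K' x z / q' z * (q y * P y z) ≤ 1 := by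
    rw [← hone]
    refine sum_le_sum fun x hx => ?_
    rw [sum_comm, sum_comm (s := Y)]
    refine sum_le_sum fun z _ => ?_
    rw [← mul_sum, ← hq']
    simp_rw [mul_assoc (w x) (K x _)]
    rw [← mul_sum, ← hK' x hx]
    rcases (hq'0 z).eq_or_lt with h | h
    · rw [← h, mul_zero]
      exact mul_nonneg (hw x) (hK'0 x hx z)
    · rw [div_mul_cancel₀ _ h.ne']
  simp_rw [mul_add, mul_sub, sum_add_distrib, sum_sub_distrib] at hsum
  have e1 : ∑ x ∈ X, ∑ y ∈ Y, ∑ z ∈ Z, w x * K x y * P y z * Real.log (K' x z) =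
      ∑ x ∈ X, w x * ∑ z ∈ Z, K' x z * Real.log (K' x z) := by
    refine sum_congr rfl fun x hx => ?_
    rw [sum_comm, mul_sum]
    refine sum_congr rfl fun z _ => ?_
    rw [← sum_mul, ← mul_assoc]
    simp_rw [mul_assoc (w x) (K x _)]
    rw [← mul_sum, ← hK' x hx]
  have e2 : ∑ x ∈ X, ∑ y ∈ Y, ∑ z ∈ Z, w x * K x y * P y z * Real.log (q' z) =
      ∑ z ∈ Z, q' z * Real.log (q' z) := by
    rw [sum_comm]
    simp_rw [sum_comm (s := X) (t := Z)]
    rw [sum_comm]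
    refine sum_congr rfl fun z _ => ?_
    rw [hq', sum_mul]
    refine sum_congr rfl fun y _ => ?_
    rw [hq, sum_mul, sum_mul]
  have e3 : ∑ x ∈ X, ∑ y ∈ Y, ∑ z ∈ Z, w x * K x y * P y z * Real.log (K x y) =
      ∑ x ∈ X, w x * ∑ y ∈ Y, K x y * Real.log (K x y) := by
    refine sum_congr rfl fun x hx => ?_
    rw [mul_sum]
    refine sum_congr rfl fun y hy => ?_
    rw [← sum_mul, ← mul_sum, hP1 y hy]
    ring
  have e4 : ∑ x ∈ X, ∑ y ∈ Y, ∑ z ∈ Z, w x * K x y * P y z * Real.log (q y) =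
      ∑ y ∈ Y, q y * Real.log (q y) := by
    rw [sum_comm]
    refine sum_congr rfl fun y hy => ?_
    simp_rw [← sum_mul, ← mul_sum, hP1 y hy, mul_one]
    rw [← hq]
  rw [e1, e2, e3, e4, hone] at hsum
  linarith

section Walk

variable {V : Type*} {Γ : SimpleGraph V} {d : ℕ}

theorem walkP_nonneg (o : V) (n : ℕ) (v : V) : 0 ≤ walkP Γ o n v := by
  induction n generalizing v with
  | zero => simp only [walkP]; split_ifs <;> norm_num
  | succ n ih =>
    refine tsum_nonneg fun w => ?_
    split_ifs
    · exact div_nonneg (ih w) (Nat.cast_nonneg _)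
    · exact le_rfl

theorem finite_support_walkP (hlf : LocFin Γ) (o : V) (n : ℕ) :
    (Function.support (walkP Γ o n)).Finite := by
  induction n with
  | zero =>
    refine (Set.finite_singleton o).subset fun v hv => ?_
    by_contra h
    exact hv (if_neg h)
  | succ n ih =>
    refine (ih.biUnion fun w _ => hlf w).subset fun v hv => ?_
    by_contra h
    refine hv ?_
    simp only [walkP]
    convert tsum_zero with w
    split_ifs with hw
    · have : walkP Γ o n w = 0 := by
        by_contra h0
        exact h (Set.mem_biUnion (x := w) h0 hw)
      rw [this, zero_div]
    · rfl

/-- The finite set of vertices that the walk from `o` can occupy at time `n`. -/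
noncomputable def walkSupp (hlf : LocFin Γ) (o : V) (n : ℕ) : Finset V :=
  (finite_support_walkP hlf o n).toFinset

theorem mem_walkSupp (hlf : LocFin Γ) {o : V} {n : ℕ} {v : V} :
    v ∈ walkSupp hlf o n ↔ walkP Γ o n v ≠ 0 := by
  simp [walkSupp]

theorem sum_walkP_mul_eq (hlf : LocFin Γ) (o : V) (n : ℕ) (f : V → ℝ) {S : Finset V}
    (hS : walkSupp hlf o n ⊆ S) :
    ∑ v ∈ S, walkP Γ o n v * f v = ∑ v ∈ walkSupp hlf o n, walkP Γ o n v * f v := by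
  refine (sum_subset hS fun v _ hv => ?_).symm
  rw [not_not.1 (mt (mem_walkSupp hlf).2 hv), zero_mul]

theorem walkEnt_eq_sum (hlf : LocFin Γ) (o : V) (n : ℕ) {S : Finset V}
    (hS : walkSupp hlf o n ⊆ S) :
    walkEnt Γ o n = -∑ v ∈ S, walkP Γ o n v * Real.log (walkP Γ o n v) := by
  rw [walkEnt, tsum_eq_sum fun v hv => ?_]
  rw [not_not.1 (mt (mem_walkSupp hlf).2 (mt (@hS v) hv)), zero_mul]

theorem walkP_succ (hlf : LocFin Γ) (hreg : ∀ v, (Γ.neighborSet v).ncard = d) (o : V) (n : ℕ)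
    (v : V) : walkP Γ o (n + 1) v = ∑ w ∈ (hlf v).toFinset, walkP Γ o n w / d := by
  simp only [walkP, hreg]
  rw [tsum_eq_sum (s := (hlf v).toFinset)]
  · refine sum_congr rfl fun w hw => if_pos ?_
    exact ((hlf v).mem_toFinset.1 hw).symm
  · exact fun w hw => if_neg fun h => hw ((hlf v).mem_toFinset.2 h.symm)

theorem walkP_one (hlf : LocFin Γ) (hreg : ∀ v, (Γ.neighborSet v).ncard = d) (o v : V) :
    walkP Γ o 1 v = if Γ.Adj o v then (1 : ℝ) / d else 0 := by
  rw [walkP_succ hlf hreg]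
  simp only [walkP, ite_div, zero_div, sum_ite_eq', Set.Finite.mem_toFinset,
    SimpleGraph.mem_neighborSet, Γ.adj_comm v o]

theorem walkSupp_one_subset (hlf : LocFin Γ) (hreg : ∀ v, (Γ.neighborSet v).ncard = d) (o : V) :
    walkSupp hlf o 1 ⊆ (hlf o).toFinset := by
  intro v hv
  rw [mem_walkSupp, walkP_one hlf hreg] at hv
  by_contra h
  exact hv (if_neg fun h' => h ((hlf o).mem_toFinset.2 h'))

theorem sum_walkP_one_mul (hlf : LocFin Γ) (hreg : ∀ v, (Γ.neighborSet v).ncard = d) (o : V)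
    (f : V → ℝ) :
    ∑ v ∈ walkSupp hlf o 1, walkP Γ o 1 v * f v = (∑ v ∈ (hlf o).toFinset, f v) / d := by
  rw [← sum_walkP_mul_eq hlf o 1 f (walkSupp_one_subset hlf hreg o), sum_div]
  refine sum_congr rfl fun v hv => ?_
  have hadj : Γ.Adj o v := (hlf o).mem_toFinset.1 hv
  rw [walkP_one hlf hreg, if_pos hadj]
  ring

theorem walkP_add (hlf : LocFin Γ) (hreg : ∀ v, (Γ.neighborSet v).ncard = d) (o : V) (m k : ℕ)
    (v : V) :
    walkP Γ o (m + k) v = ∑ x ∈ walkSupp hlf o m, walkP Γ o m x * walkP Γ x k v := by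
  induction k generalizing v with
  | zero =>
    simp only [walkP, mul_ite, mul_one, mul_zero, add_zero, sum_ite_eq]
    split_ifs with h
    · rfl
    · exact not_not.1 (mt (mem_walkSupp hlf).2 h)
  | succ k ih =>
    rw [← add_assoc, walkP_succ hlf hreg]
    simp_rw [ih, walkP_succ hlf hreg, mul_sum, sum_div]
    rw [sum_comm]
    simp_rw [mul_div_assoc]

theorem walkSupp_subset_add (hlf : LocFin Γ) (hreg : ∀ v, (Γ.neighborSet v).ncard = d) {o x : V}
    {m : ℕ} (k : ℕ) (hx : x ∈ walkSupp hlf o m) :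
    walkSupp hlf x k ⊆ walkSupp hlf o (m + k) := by
  intro v hv
  rw [mem_walkSupp] at *
  rw [walkP_add hlf hreg]
  refine (lt_of_lt_of_le ?_ (single_le_sum (f := fun x => walkP Γ o m x * walkP Γ x k v)
    (fun y _ => mul_nonneg (walkP_nonneg o m y) (walkP_nonneg y k v))
    ((mem_walkSupp hlf).2 hx))).ne'
  exact mul_pos ((walkP_nonneg o m x).lt_of_ne' hx) ((walkP_nonneg x k v).lt_of_ne' hv)

theorem sum_walkP_add (hlf : LocFin Γ) (hreg : ∀ v, (Γ.neighborSet v).ncard = d) (o : V)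
    (m k : ℕ) (f : V → ℝ) :
    ∑ v ∈ walkSupp hlf o (m + k), walkP Γ o (m + k) v * f v =
      ∑ x ∈ walkSupp hlf o m,
        walkP Γ o m x * ∑ v ∈ walkSupp hlf x k, walkP Γ x k v * f v := by
  simp_rw [walkP_add hlf hreg o m k, sum_mul]
  rw [sum_comm]
  refine sum_congr rfl fun x hx => ?_
  rw [← sum_walkP_mul_eq hlf x k f (walkSupp_subset_add hlf hreg k hx), mul_sum]
  simp_rw [mul_assoc]

theorem sum_walkP (hlf : LocFin Γ) (hreg : ∀ v, (Γ.neighborSet v).ncard = d) (hd : d ≠ 0)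
    (o : V) (n : ℕ) : ∑ v ∈ walkSupp hlf o n, walkP Γ o n v = 1 := by
  induction n with
  | zero =>
    have : walkSupp hlf o 0 = {o} := by
      ext v
      rw [mem_walkSupp]
      simp [walkP]
    rw [this, sum_singleton]
    simp [walkP]
  | succ n ih =>
    have h := sum_walkP_add hlf hreg o n 1 fun _ => 1
    simp_rw [sum_walkP_one_mul hlf hreg, mul_one] at h
    refine h.trans (Eq.trans (sum_congr rfl fun x _ => ?_) ih)
    rw [sum_const, ← Set.ncard_eq_toFinset_card _ (hlf x), hreg, nsmul_one,
      div_self (Nat.cast_ne_zero.2 hd), mul_one]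

theorem sum_walkP_eq_one (hlf : LocFin Γ) (hreg : ∀ v, (Γ.neighborSet v).ncard = d) (hd : d ≠ 0)
    (o : V) (n : ℕ) {S : Finset V} (hS : walkSupp hlf o n ⊆ S) :
    ∑ v ∈ S, walkP Γ o n v = 1 := by
  simpa [sum_walkP hlf hreg hd] using sum_walkP_mul_eq hlf o n (fun _ => 1) hS

theorem walkP_iso (hreg : ∀ v, (Γ.neighborSet v).ncard = d) (φ : Γ ≃g Γ) (o : V) (n : ℕ)
    (v : V) : walkP Γ (φ o) n (φ v) = walkP Γ o n v := by
  induction n generalizing v with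
  | zero => simp [walkP]
  | succ n ih =>
    simp only [walkP, hreg]
    rw [← φ.toEquiv.tsum_eq]
    refine tsum_congr fun w => if_congr φ.map_adj_iff ?_ rfl
    exact congrArg (· / (d : ℝ)) (ih w)

theorem walkEnt_eq (hreg : ∀ v, (Γ.neighborSet v).ncard = d) (htrans : VertexTransitive Γ)
    (o o' : V) (n : ℕ) : walkEnt Γ o n = walkEnt Γ o' n := by
  obtain ⟨φ, rfl⟩ := htrans o o'
  simp only [walkEnt]
  rw [← φ.toEquiv.tsum_eq (fun v => walkP Γ (φ o) n v * Real.log (walkP Γ (φ o) n v))]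
  simp [walkP_iso hreg]

theorem walkEnt_add_succ_sub_le (hlf : LocFin Γ) (hreg : ∀ v, (Γ.neighborSet v).ncard = d)
    (hd : d ≠ 0) (htrans : VertexTransitive Γ) (o : V) (m k : ℕ) :
    walkEnt Γ o (m + (k + 1)) - walkEnt Γ o (k + 1) ≤ walkEnt Γ o (m + k) - walkEnt Γ o k := by
  have key := mutualInfo_mono (walkSupp hlf o m) (walkSupp hlf o (m + k))
    (walkSupp hlf o (m + (k + 1))) (walkP Γ o m) (walkP Γ o (m + k)) (walkP Γ o (m + (k + 1)))
    (fun x => walkP Γ x k) (fun x => walkP Γ x (k + 1)) (fun y => walkP Γ y 1)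
    (walkP_nonneg o m) (fun x => walkP_nonneg x k) (fun y => walkP_nonneg y 1)
    (walkP_add hlf hreg o m k)
    (fun x hx z => by
      rw [walkP_add hlf hreg]
      exact (sum_walkP_mul_eq hlf x k _ (walkSupp_subset_add hlf hreg k hx)).symm)
    (walkP_add hlf hreg o (m + k) 1) (sum_walkP hlf hreg hd o m)
    (fun x hx => sum_walkP_eq_one hlf hreg hd x k (walkSupp_subset_add hlf hreg k hx))
    (fun y hy => sum_walkP_eq_one hlf hreg hd y 1 (walkSupp_subset_add hlf hreg 1 hy))
  have hcond : ∀ j, ∑ x ∈ walkSupp hlf o m, walkP Γ o m x *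
      ∑ z ∈ walkSupp hlf o (m + j), walkP Γ x j z * Real.log (walkP Γ x j z) =
        -walkEnt Γ o j := fun j => by
    have : ∀ x ∈ walkSupp hlf o m, walkP Γ o m x *
        ∑ z ∈ walkSupp hlf o (m + j), walkP Γ x j z * Real.log (walkP Γ x j z) =
          walkP Γ o m x * -walkEnt Γ o j := fun x hx => by
      rw [walkEnt_eq hreg htrans o x,
        walkEnt_eq_sum hlf x j (walkSupp_subset_add hlf hreg j hx), neg_neg]
    rw [sum_congr rfl this, ← sum_mul, sum_walkP hlf hreg hd, one_mul]
  rw [hcond, hcond] at key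
  rw [walkEnt_eq_sum hlf o (m + k) subset_rfl, walkEnt_eq_sum hlf o (m + (k + 1)) subset_rfl]
  linarith

theorem walkEnt_mul_le (hlf : LocFin Γ) (hreg : ∀ v, (Γ.neighborSet v).ncard = d)
    (hd : d ≠ 0) (htrans : VertexTransitive Γ) (o : V) (n j : ℕ) :
    walkEnt Γ o ((j + 1) * n) ≤
      walkEnt Γ o n + j * (walkEnt Γ o (2 * n) - walkEnt Γ o n) := by
  have hanti : Antitone fun k => walkEnt Γ o (n + k) - walkEnt Γ o k :=
    antitone_nat_of_succ_le (walkEnt_add_succ_sub_le hlf hreg hd htrans o n)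
  induction j with
  | zero => simp
  | succ j ih =>
    have h := hanti (show n ≤ (j + 1) * n from Nat.le_mul_of_pos_left n j.succ_pos)
    simp only [← two_mul] at h
    rw [show (j + 1 + 1) * n = n + (j + 1) * n by ring]
    push_cast
    linarith

end Walk

section Modular

open MulAction Subgroup

theorem relIndex_stabilizer_eq_ncard {G X : Type*} [Group G] [MulAction G X] (x y : X) :
    (stabilizer G y).relIndex (stabilizer G x) = {z | ∃ g : G, g • x = x ∧ g • y = z}.ncard := by
  have h : (stabilizer G y).subgroupOf (stabilizer G x) = stabilizer (stabilizer G x) y := by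
    ext g
    rfl
  rw [relIndex, h, index_stabilizer]
  congr 1
  ext z
  simp only [mem_orbit_iff, Set.mem_ofPred_eq, Subtype.exists, mem_stabilizer_iff,
    subgroup_smul_def, exists_prop]

/-- The cocycle identity for the indices of mutually commensurable subgroups. -/
theorem relIndex_cocycle {G : Type*} [Group G] {A B C : Subgroup G} (hBA : B.relIndex A ≠ 0)
    (hAB : A.relIndex B ≠ 0) (hCA : C.relIndex A ≠ 0) :
    B.relIndex A * C.relIndex B * A.relIndex C = A.relIndex B * B.relIndex C * C.relIndex A := by
  have hABC : (B ⊓ C).relIndex A ≠ 0 := relIndex_inf_ne_zero hBA hCA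
  have hI : (A ⊓ B ⊓ C).relIndex A ≠ 0 := by
    rwa [inf_assoc, inf_comm, inf_relIndex_right]
  have hpair : ∀ K L : Subgroup G, A ⊓ B ⊓ C ≤ K ⊓ L →
      (A ⊓ B ⊓ C).relIndex (K ⊓ L) * K.relIndex L = (A ⊓ B ⊓ C).relIndex L := fun K L h => by
    rw [← inf_relIndex_right K L, relIndex_mul_relIndex _ _ _ h inf_le_right]
  have hA : A ⊓ B ⊓ C ≤ A := inf_le_left.trans inf_le_left
  have hB : A ⊓ B ⊓ C ≤ B := inf_le_left.trans inf_le_right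
  have hC : A ⊓ B ⊓ C ≤ C := inf_le_right
  have e1 := hpair B A (le_inf hB hA)
  have e2 := hpair A B (le_inf hA hB)
  have e3 := hpair C B (le_inf hC hB)
  have e4 := hpair B C (le_inf hB hC)
  have e5 := hpair A C (le_inf hA hC)
  have e6 := hpair C A (le_inf hC hA)
  rw [inf_comm B A] at e1
  rw [inf_comm C B] at e3
  rw [inf_comm C A] at e6
  have n1 : (A ⊓ B ⊓ C).relIndex (A ⊓ B) ≠ 0 := left_ne_zero_of_mul (e1.trans_ne hI)
  have n2 : (A ⊓ B ⊓ C).relIndex (A ⊓ C) ≠ 0 := left_ne_zero_of_mul (e6.trans_ne hI)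
  have hIB : (A ⊓ B ⊓ C).relIndex B ≠ 0 := by
    rw [← e2]
    exact mul_ne_zero n1 hAB
  have n3 : (A ⊓ B ⊓ C).relIndex (B ⊓ C) ≠ 0 := left_ne_zero_of_mul (e3.trans_ne hIB)
  refine mul_left_cancel₀ (mul_ne_zero (mul_ne_zero n1 n2) n3) ?_
  calc _ = ((A ⊓ B ⊓ C).relIndex (A ⊓ B) * B.relIndex A) *
        ((A ⊓ B ⊓ C).relIndex (B ⊓ C) * C.relIndex B) *
        ((A ⊓ B ⊓ C).relIndex (A ⊓ C) * A.relIndex C) := by ring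
    _ = ((A ⊓ B ⊓ C).relIndex (A ⊓ B) * A.relIndex B) *
        ((A ⊓ B ⊓ C).relIndex (B ⊓ C) * B.relIndex C) *
        ((A ⊓ B ⊓ C).relIndex (A ⊓ C) * C.relIndex A) := by
      rw [e1, e2, e3, e4, e5, e6]
      ring
    _ = _ := by ring

variable {V : Type*} {Γ : SimpleGraph V} {d : ℕ}

/-- The orbit of `w` under the stabilizer of `v` in the automorphism group. -/
def stabOrbit (Γ : SimpleGraph V) (v w : V) : Set V := {x | ∃ φ : Γ ≃g Γ, φ v = v ∧ φ w = x}

theorem ncard_stabOrbit (v w : V) :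
    (stabOrbit Γ v w).ncard = (stabilizer (Γ ≃g Γ) w).relIndex (stabilizer (Γ ≃g Γ) v) :=
  (relIndex_stabilizer_eq_ncard v w).symm

theorem exists_walkP_pos (hconn : Γ.Connected) (hlf : LocFin Γ)
    (hreg : ∀ v, (Γ.neighborSet v).ncard = d) (v w : V) : ∃ n, 0 < walkP Γ v n w := by
  induction (Γ.reachable_iff_reflTransGen v w).1 (hconn.preconnected v w) with
  | refl => exact ⟨0, by simp [walkP]⟩
  | @tail b c _ hbc ih =>
    obtain ⟨n, hn⟩ := ih
    have hd : 0 < d := by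
      rw [← hreg b, Set.ncard_pos (hlf b)]
      exact ⟨c, hbc⟩
    refine ⟨n + 1, ?_⟩
    rw [walkP_succ hlf hreg]
    exact sum_pos' (fun x _ => div_nonneg (walkP_nonneg v n x) (Nat.cast_nonneg _))
      ⟨b, (hlf c).mem_toFinset.2 hbc.symm, div_pos hn (Nat.cast_pos.2 hd)⟩

theorem walkP_eq_of_mem_stabOrbit (hreg : ∀ v, (Γ.neighborSet v).ncard = d) {v w x : V}
    (hx : x ∈ stabOrbit Γ v w) (n : ℕ) : walkP Γ v n x = walkP Γ v n w := by
  obtain ⟨φ, hv, rfl⟩ := hx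
  conv_lhs => rw [← hv]
  exact walkP_iso hreg φ v n w

theorem stabOrbit_subset_walkSupp (hlf : LocFin Γ) (hreg : ∀ v, (Γ.neighborSet v).ncard = d)
    {v w : V} {n : ℕ} (h : w ∈ walkSupp hlf v n) : stabOrbit Γ v w ⊆ walkSupp hlf v n := by
  intro x hx
  rw [mem_coe, mem_walkSupp, walkP_eq_of_mem_stabOrbit hreg hx]
  exact (mem_walkSupp hlf).1 h

theorem finite_stabOrbit (hconn : Γ.Connected) (hlf : LocFin Γ)
    (hreg : ∀ v, (Γ.neighborSet v).ncard = d) (v w : V) : (stabOrbit Γ v w).Finite := by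
  obtain ⟨n, hn⟩ := exists_walkP_pos hconn hlf hreg v w
  exact (finite_toSet _).subset
    (stabOrbit_subset_walkSupp hlf hreg ((mem_walkSupp hlf).2 hn.ne'))

theorem ncard_stabOrbit_pos (hconn : Γ.Connected) (hlf : LocFin Γ)
    (hreg : ∀ v, (Γ.neighborSet v).ncard = d) (v w : V) : 0 < (stabOrbit Γ v w).ncard :=
  (Set.ncard_pos (finite_stabOrbit hconn hlf hreg v w)).2 ⟨w, 1, rfl, rfl⟩

theorem ncard_stabOrbit_iso (φ : Γ ≃g Γ) (v w : V) :
    (stabOrbit Γ (φ v) (φ w)).ncard = (stabOrbit Γ v w).ncard := by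
  rw [← Set.ncard_image_of_injective (stabOrbit Γ v w) φ.injective]
  congr 1
  ext x
  constructor
  · rintro ⟨ψ, hv, rfl⟩
    exact ⟨φ⁻¹ (ψ (φ w)), ⟨φ⁻¹ * ψ * φ, by simp [RelIso.mul_apply, hv], rfl⟩, by simp⟩
  · rintro ⟨_, ⟨ψ, hv, rfl⟩, rfl⟩
    exact ⟨φ * ψ * φ⁻¹, by simp [RelIso.mul_apply, hv], by simp [RelIso.mul_apply]⟩

theorem walkP_mul_ncard_stabOrbit_le (hlf : LocFin Γ)
    (hreg : ∀ v, (Γ.neighborSet v).ncard = d) (hd : d ≠ 0) {v w : V} {n : ℕ}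
    (h : w ∈ walkSupp hlf v n) : walkP Γ v n w * (stabOrbit Γ v w).ncard ≤ 1 := by
  have hsub := stabOrbit_subset_walkSupp hlf hreg h
  have hfin := (finite_toSet (walkSupp hlf v n)).subset hsub
  rw [← sum_walkP hlf hreg hd v n, Set.ncard_eq_toFinset_card _ hfin, mul_comm, ← nsmul_eq_mul,
    ← sum_const]
  rw [sum_congr rfl fun x hx =>
    (walkP_eq_of_mem_stabOrbit hreg (hfin.mem_toFinset.1 hx) n).symm]
  exact sum_le_sum_of_subset_of_nonneg (fun x hx => hsub (hfin.mem_toFinset.1 hx))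
    fun x _ _ => walkP_nonneg v n x

/-- The logarithm of the modular function of the automorphism group. -/
noncomputable def logModular (Γ : SimpleGraph V) (v w : V) : ℝ :=
  Real.log (stabOrbit Γ v w).ncard - Real.log (stabOrbit Γ w v).ncard

theorem logModular_iso (φ : Γ ≃g Γ) (v w : V) :
    logModular Γ (φ v) (φ w) = logModular Γ v w := by
  simp only [logModular, ncard_stabOrbit_iso]

theorem logModular_add (hconn : Γ.Connected) (hlf : LocFin Γ)
    (hreg : ∀ v, (Γ.neighborSet v).ncard = d) (u v w : V) :
    logModular Γ u v + logModular Γ v w = logModular Γ u w := by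
  have hpos : ∀ x y, ((stabOrbit Γ x y).ncard : ℝ) ≠ 0 := fun x y =>
    Nat.cast_ne_zero.2 (ncard_stabOrbit_pos hconn hlf hreg x y).ne'
  have hne : ∀ x y, (stabilizer (Γ ≃g Γ) y).relIndex (stabilizer (Γ ≃g Γ) x) ≠ 0 := fun x y =>
    ncard_stabOrbit (Γ := Γ) x y ▸ (ncard_stabOrbit_pos hconn hlf hreg x y).ne'
  have h := relIndex_cocycle (hne u v) (hne v u) (hne u w)
  simp only [← ncard_stabOrbit] at h
  have hlog := congrArg (fun n : ℕ => Real.log n) h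
  simp only [Nat.cast_mul] at hlog
  rw [Real.log_mul (mul_ne_zero (hpos _ _) (hpos _ _)) (hpos _ _),
    Real.log_mul (hpos _ _) (hpos _ _),
    Real.log_mul (mul_ne_zero (hpos _ _) (hpos _ _)) (hpos _ _),
    Real.log_mul (hpos _ _) (hpos _ _)] at hlog
  simp only [logModular]
  linarith

theorem exists_adj_logModular_ne_zero (hconn : Γ.Connected) (hlf : LocFin Γ)
    (hreg : ∀ v, (Γ.neighborSet v).ncard = d) (hnotuni : ¬ GraphUnimodular Γ) :
    ∃ u v, Γ.Adj u v ∧ logModular Γ u v ≠ 0 := by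
  by_contra! hcon
  refine hnotuni fun v w => ?_
  have h0 : logModular Γ v w = 0 := by
    induction (Γ.reachable_iff_reflTransGen v w).1 (hconn.preconnected v w) with
    | refl => exact sub_self _
    | tail _ hbc ih => rw [← logModular_add hconn hlf hreg v _ _, ih, hcon _ _ hbc, add_zero]
  have hinj := Real.log_injOn_pos
    (Nat.cast_pos.2 (ncard_stabOrbit_pos hconn hlf hreg v w) : (0 : ℝ) < _)
    (Nat.cast_pos.2 (ncard_stabOrbit_pos hconn hlf hreg w v) : (0 : ℝ) < _) (sub_eq_zero.1 h0)
  exact_mod_cast hinj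

/-- The mass transport principle for the edges at `o`: the reciprocals of the modular function
average to one over the neighbours of `o`. -/
theorem sum_ncard_stabOrbit_div (hconn : Γ.Connected) (hlf : LocFin Γ)
    (htrans : VertexTransitive Γ) (hreg : ∀ v, (Γ.neighborSet v).ncard = d) (o : V) :
    ∑ v ∈ (hlf o).toFinset, ((stabOrbit Γ v o).ncard : ℝ) / (stabOrbit Γ o v).ncard = d := by
  set N := (hlf o).toFinset with hN
  have hmemN : ∀ v, v ∈ N ↔ Γ.Adj o v := fun v => (hlf o).mem_toFinset
  let S : V → V → Prop := fun v w => ∃ φ : Γ ≃g Γ, φ v = o ∧ φ o = w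
  have hsymm : ∀ v w, S v w → S w v := by
    rintro v w ⟨φ, hv, hw⟩
    exact ⟨φ⁻¹, by simp [← hw], by simp [← hv]⟩
  have hcount : ∀ v ∈ N, ((stabOrbit Γ v o).ncard : ℝ) = ∑ w ∈ N, if S v w then 1 else 0 := by
    intro v hv
    obtain ⟨φ, hφ⟩ := htrans v o
    rw [← ncard_stabOrbit_iso φ v o, hφ, sum_boole]
    congr 1
    rw [← Set.ncard_coe_finset]
    congr 1
    ext w
    simp only [coe_filter, Set.mem_ofPred_eq, hmemN]
    constructor
    · rintro ⟨ψ, ho, rfl⟩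
      refine ⟨?_, ψ * φ, by simp [RelIso.mul_apply, hφ, ho], rfl⟩
      have : Γ.Adj (ψ (φ o)) (ψ (φ v)) :=
        ψ.map_adj_iff.2 (φ.map_adj_iff.2 ((hmemN v).1 hv))
      rw [hφ, ho] at this
      exact this.symm
    · rintro ⟨-, ψ, hv', rfl⟩
      exact ⟨ψ * φ⁻¹, by simp [RelIso.mul_apply, ← hφ, hv'], by simp [RelIso.mul_apply]⟩
  have hS : ∀ v w, S v w → (stabOrbit Γ o w).ncard = (stabOrbit Γ v o).ncard := by
    rintro v w ⟨φ, hv, rfl⟩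
    rw [← ncard_stabOrbit_iso φ v o, hv]
  calc ∑ v ∈ N, ((stabOrbit Γ v o).ncard : ℝ) / (stabOrbit Γ o v).ncard
      = ∑ v ∈ N, ∑ w ∈ N, (if S v w then 1 else 0) / ((stabOrbit Γ o v).ncard : ℝ) :=
        sum_congr rfl fun v hv => by rw [hcount v hv, sum_div]
    _ = ∑ w ∈ N, ∑ v ∈ N, (if S w v then 1 else 0) / ((stabOrbit Γ w o).ncard : ℝ) := by
        rw [sum_comm]
        refine sum_congr rfl fun w _ => sum_congr rfl fun v _ => ?_
        by_cases h : S v w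
        · rw [if_pos h, if_pos (hsymm v w h), hS w v (hsymm v w h)]
        · rw [if_neg h, if_neg (mt (hsymm w v) h), zero_div, zero_div]
    _ = ∑ w ∈ N, 1 := sum_congr rfl fun w hw => by
        rw [← sum_div, ← hcount w hw, div_self]
        exact Nat.cast_ne_zero.2 (ncard_stabOrbit_pos hconn hlf hreg w o).ne'
    _ = d := by
        rw [sum_const, nsmul_one, hN, ← Set.ncard_eq_toFinset_card _ (hlf o), hreg]

theorem sq_div_two_le_neg_log_add {t : ℝ} (h0 : 0 < t) (h1 : t ≤ 1) :
    (1 - t) ^ 2 / 2 ≤ -Real.log t - (1 - t) := by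
  have h := Real.hasSum_pow_div_log_of_abs_lt_one (x := 1 - t)
    (abs_lt.2 ⟨by linarith, by linarith⟩)
  have hle := sum_le_hasSum (range 2) (fun i _ => by
    have : 0 ≤ 1 - t := by linarith
    positivity) h
  norm_num [sum_range_succ] at hle
  linarith

/-- The drift of the logarithm of the modular function along the walk. -/
theorem le_sum_logModular (hconn : Γ.Connected) (hlf : LocFin Γ)
    (htrans : VertexTransitive Γ) (hreg : ∀ v, (Γ.neighborSet v).ncard = d)
    (hnotuni : ¬ GraphUnimodular Γ) (o : V) :
    1 / (2 * (d : ℝ)) ≤ ∑ v ∈ (hlf o).toFinset, logModular Γ o v := by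
  set a : V → ℝ := fun v => (stabOrbit Γ o v).ncard with ha
  set b : V → ℝ := fun v => (stabOrbit Γ v o).ncard with hb
  have ha0 : ∀ v, 0 < a v := fun v => Nat.cast_pos.2 (ncard_stabOrbit_pos hconn hlf hreg o v)
  have hb0 : ∀ v, 0 < b v := fun v => Nat.cast_pos.2 (ncard_stabOrbit_pos hconn hlf hreg v o)
  have hmod : ∀ v, logModular Γ o v = -Real.log (b v / a v) := fun v => by
    rw [Real.log_div (hb0 v).ne' (ha0 v).ne', neg_sub]
    rfl
  have hcard : ∑ v ∈ (hlf o).toFinset, (1 : ℝ) = d := by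
    rw [sum_const, nsmul_one, ← Set.ncard_eq_toFinset_card _ (hlf o), hreg]
  have hsum : ∑ v ∈ (hlf o).toFinset, b v / a v = d :=
    sum_ncard_stabOrbit_div hconn hlf htrans hreg o
  have hrw : ∑ v ∈ (hlf o).toFinset, logModular Γ o v =
      ∑ v ∈ (hlf o).toFinset, (logModular Γ o v - (1 - b v / a v)) := by
    rw [sum_sub_distrib, sum_sub_distrib, hcard, hsum]
    ring
  have hnonneg : ∀ v, 0 ≤ logModular Γ o v - (1 - b v / a v) := fun v => by
    have := Real.log_le_sub_one_of_pos (div_pos (hb0 v) (ha0 v))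
    rw [hmod]
    linarith
  obtain ⟨v, hv, hlt⟩ : ∃ v ∈ (hlf o).toFinset, b v < a v := by
    by_contra! hcon
    obtain ⟨u, v, huv, hne⟩ := exists_adj_logModular_ne_zero hconn hlf hreg hnotuni
    obtain ⟨φ, rfl⟩ := htrans u o
    refine hne ?_
    rw [← logModular_iso φ, hmod]
    have h1 := (sum_eq_sum_iff_of_le fun v hv => (one_le_div (ha0 v)).2 (hcon v hv)).1
      (hcard.trans hsum.symm) (φ v) ((hlf _).mem_toFinset.2 (φ.map_adj_iff.2 huv))
    rw [← h1, Real.log_one, neg_zero]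
  have hadj : Γ.Adj o v := (hlf o).mem_toFinset.1 hv
  have had : a v ≤ d := by
    simp only [ha, ← hreg o]
    refine Nat.cast_le.2 (Set.ncard_le_ncard ?_ (hlf o))
    rintro x ⟨φ, ho, rfl⟩
    have : Γ.Adj (φ o) (φ v) := φ.map_adj_iff.2 hadj
    rwa [ho] at this
  have hab : b v + 1 ≤ a v := by
    simp only [ha, hb] at hlt ⊢
    exact_mod_cast hlt
  have horbit : stabOrbit Γ o v ⊆ ((hlf o).toFinset : Set V) := by
    rintro x ⟨φ, ho, rfl⟩
    have : Γ.Adj (φ o) (φ v) := φ.map_adj_iff.2 hadj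
    rw [ho] at this
    exact (hlf o).mem_toFinset.2 this
  have hfin := finite_stabOrbit hconn hlf hreg o v
  have hterm : ∀ x ∈ hfin.toFinset, logModular Γ o x - (1 - b x / a x) =
      logModular Γ o v - (1 - b v / a v) := by
    intro x hx
    obtain ⟨φ, ho, rfl⟩ := hfin.mem_toFinset.1 hx
    have e1 : a (φ v) = a v := by
      simp only [ha]
      rw [← ncard_stabOrbit_iso φ o v, ho]
    have e2 : b (φ v) = b v := by
      simp only [hb]
      rw [← ncard_stabOrbit_iso φ v o, ho]
    rw [hmod, hmod, e1, e2]
  rw [hrw]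
  refine le_trans ?_ (sum_le_sum_of_subset_of_nonneg (s := hfin.toFinset)
    (fun x hx => horbit (hfin.mem_toFinset.1 hx)) fun x _ _ => hnonneg x)
  rw [sum_congr rfl hterm, sum_const, ← Set.ncard_eq_toFinset_card _ hfin, nsmul_eq_mul]
  have hquad := sq_div_two_le_neg_log_add (div_pos (hb0 v) (ha0 v))
    ((div_le_one (ha0 v)).2 hlt.le)
  rw [hmod]
  refine le_trans ?_ (mul_le_mul_of_nonneg_left hquad (ha0 v).le)
  have hav := ha0 v
  have heq : a v * ((1 - b v / a v) ^ 2 / 2) = (a v - b v) ^ 2 / (2 * a v) := by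
    field_simp
  rw [heq]
  exact div_le_div₀ (sq_nonneg _) (by nlinarith) (by positivity) (by linarith)

theorem sum_walkP_mul_logModular (hconn : Γ.Connected) (hlf : LocFin Γ)
    (htrans : VertexTransitive Γ) (hreg : ∀ v, (Γ.neighborSet v).ncard = d) (hd : d ≠ 0)
    (o : V) (n : ℕ) :
    ∑ v ∈ walkSupp hlf o n, walkP Γ o n v * logModular Γ o v =
      n * ((∑ v ∈ (hlf o).toFinset, logModular Γ o v) / d) := by
  induction n with
  | zero =>
    rw [Nat.cast_zero, zero_mul]
    refine sum_eq_zero fun v _ => ?_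
    simp only [walkP]
    split_ifs with h
    · simp [logModular, h]
    · rw [zero_mul]
  | succ n ih =>
    have hstep : ∀ x, ∑ v ∈ walkSupp hlf x 1, walkP Γ x 1 v * logModular Γ o v =
        logModular Γ o x + (∑ v ∈ (hlf o).toFinset, logModular Γ o v) / d := by
      intro x
      obtain ⟨φ, rfl⟩ := htrans o x
      have hsplit : ∀ v ∈ walkSupp hlf (φ o) 1, walkP Γ (φ o) 1 v * logModular Γ o v =
          walkP Γ (φ o) 1 v * logModular Γ o (φ o) +
            walkP Γ (φ o) 1 v * logModular Γ (φ o) v := fun v _ => by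
        rw [← logModular_add hconn hlf hreg o (φ o) v, mul_add]
      rw [sum_congr rfl hsplit, sum_add_distrib, ← sum_mul, sum_walkP hlf hreg hd, one_mul,
        sum_walkP_one_mul hlf hreg]
      congr 2
      refine (sum_bij (fun v _ => φ v) (fun v hv => ?_) (fun _ _ _ _ h => φ.injective h)
        (fun w hw => ?_) fun v _ => (logModular_iso φ o v).symm).symm
      · rw [Set.Finite.mem_toFinset] at *
        exact φ.map_adj_iff.2 hv
      · obtain ⟨v, rfl⟩ := φ.surjective w
        rw [Set.Finite.mem_toFinset] at hw
        exact ⟨v, (hlf o).mem_toFinset.2 (φ.map_adj_iff.1 hw), rfl⟩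
    rw [sum_walkP_add hlf hreg]
    simp_rw [hstep, mul_add, sum_add_distrib]
    rw [ih, ← sum_mul, sum_walkP hlf hreg hd]
    push_cast
    ring

theorem sum_walkP_mul_logModular_le_walkEnt (hconn : Γ.Connected) (hlf : LocFin Γ)
    (hreg : ∀ v, (Γ.neighborSet v).ncard = d) (hd : d ≠ 0) (o : V) (n : ℕ) :
    ∑ v ∈ walkSupp hlf o n, walkP Γ o n v * logModular Γ o v ≤ walkEnt Γ o n := by
  rw [walkEnt_eq_sum hlf o n subset_rfl, ← sum_neg_distrib]
  refine sum_le_sum fun v hv => ?_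
  have hp : 0 < walkP Γ o n v :=
    (walkP_nonneg o n v).lt_of_ne' ((mem_walkSupp hlf).1 hv)
  have ha : (0 : ℝ) < (stabOrbit Γ o v).ncard :=
    Nat.cast_pos.2 (ncard_stabOrbit_pos hconn hlf hreg o v)
  have hlog := Real.log_le_log (mul_pos hp ha) (walkP_mul_ncard_stabOrbit_le hlf hreg hd hv)
  rw [Real.log_mul hp.ne' ha.ne', Real.log_one] at hlog
  have hb : 0 ≤ Real.log (stabOrbit Γ v o).ncard := Real.log_natCast_nonneg _
  rw [← mul_neg]
  refine mul_le_mul_of_nonneg_left ?_ hp.le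
  simp only [logModular]
  linarith

end Modular

theorem le_of_forall_nat_mul_le {a b c : ℝ} (h : ∀ j : ℕ, j * a ≤ c + j * b) : a ≤ b := by
  by_contra! hlt
  obtain ⟨j, hj⟩ := exists_nat_gt (c / (a - b))
  rw [div_lt_iff₀ (sub_pos.2 hlt)] at hj
  linarith [h j]

theorem stmt16 (V : Type) (Γ : SimpleGraph V) (o : V) (d : ℕ)
    (hconn : Γ.Connected) (hlf : LocFin Γ) (htrans : VertexTransitive Γ)
    (hreg : ∀ v, (Γ.neighborSet v).ncard = d)
    (hnotuni : ¬ GraphUnimodular Γ) :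
    ∀ n : ℕ, 1 ≤ n →
      (n : ℝ) / (2 * (d : ℝ) ^ 2) ≤ walkEnt Γ o (2 * n) - walkEnt Γ o n := by
  intro n _
  obtain ⟨u, v, huv, -⟩ := exists_adj_logModular_ne_zero hconn hlf hreg hnotuni
  have hd : d ≠ 0 := by
    rw [← hreg u]
    exact (Set.ncard_pos (hlf u)).2 ⟨v, huv⟩ |>.ne'
  refine le_of_forall_nat_mul_le (c := walkEnt Γ o n) fun j => ?_
  have hlower := sum_walkP_mul_logModular_le_walkEnt hconn hlf hreg hd o ((j + 1) * n)
  rw [sum_walkP_mul_logModular hconn hlf htrans hreg hd] at hlower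
  have hupper := walkEnt_mul_le hlf hreg hd htrans o n j
  have hdrift := div_le_div_of_nonneg_right (le_sum_logModular hconn hlf htrans hreg hnotuni o)
    (Nat.cast_nonneg (α := ℝ) d)
  have hscale := mul_le_mul_of_nonneg_left hdrift (Nat.cast_nonneg (α := ℝ) ((j + 1) * n))
  have hrate : (j : ℝ) * (n / (2 * (d : ℝ) ^ 2)) ≤
      (((j + 1) * n : ℕ) : ℝ) * (1 / (2 * (d : ℝ)) / d) := by
    have hpos : 0 ≤ (n : ℝ) / (2 * (d : ℝ) ^ 2) := by positivity
    have heq : (((j + 1) * n : ℕ) : ℝ) * (1 / (2 * (d : ℝ)) / d) =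
        (j + 1) * (n / (2 * (d : ℝ) ^ 2)) := by
      push_cast
      field_simp
    rw [heq]
    linarith
  linarith
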